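/- Let p > 1 be real. The infimum, over all lattices Λ admissible for D_p that possess a ℤ-basis u, v with all three points u, v, u + v on the boundary curve |x|ᵖ + |y|ᵖ = 1, of the area of the inscribed hexagon conv{±u, ±v, ±(u + v)}, equals 3·Δ(D_p), where Δ(D_p) is the critical determinant of D_p. -/

import Mathlib

noncomputable section

/-- The lattice in `ℝ²` spanned over `ℤ` by `u` and `v`. -/
def latticeOf (u v : ℝ × ℝ) : Set (ℝ × ℝ) := {z | ∃ m k : ℤ, z = m • u + k • v}

/-- The covolume of the lattice with `ℤ`-basis `u`, `v`. -/
def covol (u v : ℝ × ℝ) : ℝ := |u.1 * v.2 - u.2 * v.1|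

/-- The lattice with `ℤ`-basis `u`, `v` is admissible for `D_p`. -/
def IsAdmissible (p : ℝ) (u v : ℝ × ℝ) : Prop :=
  covol u v ≠ 0 ∧ ∀ z ∈ latticeOf u v, z ≠ 0 → 1 ≤ |z.1| ^ p + |z.2| ^ p

/-- The critical determinant `Δ(D_p)`. -/
def criticalDet (p : ℝ) : ℝ :=
  sInf {d : ℝ | ∃ u v : ℝ × ℝ, IsAdmissible p u v ∧ d = covol u v}

/-- The `p`-norm on the plane. -/
def pN (p : ℝ) (z : ℝ × ℝ) : ℝ := (|z.1| ^ p + |z.2| ^ p) ^ (1 / p)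

lemma pN_add (p : ℝ) (hp : 1 < p) (z w : ℝ × ℝ) : pN p (z + w) ≤ pN p z + pN p w := by
  have h := Real.Lp_add_le (Finset.univ : Finset (Fin 2)) ![z.1, z.2] ![w.1, w.2] hp.le
  simpa [pN, Fin.sum_univ_two] using h

lemma pN_smul (p : ℝ) (hp : 1 < p) (c : ℝ) (z : ℝ × ℝ) : pN p (c • z) = |c| * pN p z := by
  have h0 : p ≠ 0 := by positivity
  unfold pN
  simp only [Prod.smul_fst, Prod.smul_snd, smul_eq_mul, abs_mul]
  rw [Real.mul_rpow (abs_nonneg _) (abs_nonneg _), Real.mul_rpow (abs_nonneg _) (abs_nonneg _),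
    ← mul_add, Real.mul_rpow (by positivity) (by positivity), ← Real.rpow_mul (abs_nonneg _),
    mul_one_div_cancel h0, Real.rpow_one]

lemma pN_nonneg (p : ℝ) (z : ℝ × ℝ) : 0 ≤ pN p z := by
  unfold pN; positivity

lemma pN_neg (p : ℝ) (z : ℝ × ℝ) : pN p (-z) = pN p z := by
  simp [pN]

lemma pN_cont (p : ℝ) (hp : 1 < p) : Continuous (pN p) := by
  unfold pN
  have h0 : 0 ≤ p := by positivity
  have h1 : 0 ≤ 1 / p := by positivity
  refine Continuous.rpow_const ?_ (fun _ => Or.inr h1)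
  exact (Continuous.rpow_const (by fun_prop) (fun _ => Or.inr h0)).add
    (Continuous.rpow_const (by fun_prop) (fun _ => Or.inr h0))

lemma pN_fst (p : ℝ) (hp : 1 < p) (z : ℝ × ℝ) : |z.1| ≤ pN p z := by
  have h0 : p ≠ 0 := by positivity
  have h1 : 0 ≤ 1 / p := by positivity
  have h : (|z.1| ^ p) ^ (1 / p) ≤ pN p z := by
    unfold pN
    refine Real.rpow_le_rpow (by positivity) ?_ h1
    have : 0 ≤ |z.2| ^ p := by positivity
    linarith
  rwa [← Real.rpow_mul (abs_nonneg _), mul_one_div_cancel h0, Real.rpow_one] at h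

lemma pN_snd (p : ℝ) (hp : 1 < p) (z : ℝ × ℝ) : |z.2| ≤ pN p z := by
  have h := pN_fst p hp (z.2, z.1)
  simpa [pN, add_comm] using h

lemma pN_ge_one (p : ℝ) (hp : 1 < p) (z : ℝ × ℝ) : 1 ≤ pN p z ↔ 1 ≤ |z.1| ^ p + |z.2| ^ p := by
  have h1 : 0 < 1 / p := by positivity
  unfold pN
  have h2 : 0 ≤ |z.1| ^ p + |z.2| ^ p := by positivity
  have h3 := Real.rpow_le_rpow_iff zero_le_one h2 h1
  rwa [Real.one_rpow] at h3

lemma pN_eq_one (p : ℝ) (hp : 1 < p) (z : ℝ × ℝ) : pN p z = 1 ↔ |z.1| ^ p + |z.2| ^ p = 1 := by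
  have h1 : 1 / p ≠ 0 := by positivity
  unfold pN
  have h2 : 0 ≤ |z.1| ^ p + |z.2| ^ p := by positivity
  have h3 := Real.rpow_left_inj h2 zero_le_one h1
  rwa [Real.one_rpow] at h3

lemma pN_sub_le (p : ℝ) (hp : 1 < p) (z w : ℝ × ℝ) : pN p z - pN p w ≤ pN p (z + w) := by
  have h := pN_add p hp (z + w) (-w)
  rw [pN_neg] at h
  simp only [add_neg_cancel_right] at h
  linarith

/-- Three points on the boundary force admissibility. -/
lemma adm_of_three (p : ℝ) (hp : 1 < p) (u v : ℝ × ℝ) (hc : covol u v ≠ 0)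
    (hu : pN p u = 1) (hv : pN p v = 1) (huv : pN p (u + v) = 1) : IsAdmissible p u v := by
  refine ⟨hc, ?_⟩
  rintro z ⟨m, k, rfl⟩ hz
  rw [← pN_ge_one p hp]
  have e : m • u + k • v = (m : ℝ) • u + (k : ℝ) • v := by
    rw [Int.cast_smul_eq_zsmul, Int.cast_smul_eq_zsmul]
  rw [e]
  have h1 := pN_sub_le p hp ((m : ℝ) • u) ((k : ℝ) • v)
  have h2 := pN_sub_le p hp ((k : ℝ) • v) ((m : ℝ) • u)
  rw [add_comm ((k : ℝ) • v)] at h2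
  rw [pN_smul p hp, pN_smul p hp, hu, hv] at h1 h2
  rcases lt_trichotomy |m| |k| with h | h | h
  · have : ((|m| + 1 : ℤ) : ℝ) ≤ ((|k| : ℤ) : ℝ) := by exact_mod_cast h
    push_cast at this
    linarith
  · have hk : k ≠ 0 := by
      rintro rfl
      simp at h
      subst h
      simp at hz
    have hk1 : (1 : ℝ) ≤ |(k : ℝ)| := by
      have := Int.one_le_abs hk
      exact_mod_cast this
    rcases abs_eq_abs.1 h with h | h
    · rw [h, ← smul_add, pN_smul p hp, huv]; linarith
    · have e2 : ((m : ℝ) • u + (k : ℝ) • v) = (k : ℝ) • (v + (-1 : ℝ) • u) := by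
        rw [h]; push_cast; module
      rw [e2, pN_smul p hp]
      have h3 : 1 ≤ pN p (v + (-1 : ℝ) • u) := by
        have h4 := pN_sub_le p hp ((2 : ℝ) • v) (-(u + v))
        rw [pN_neg, huv, pN_smul p hp, hv] at h4
        have e3 : (2 : ℝ) • v + -(u + v) = v + (-1 : ℝ) • u := by module
        rw [e3] at h4
        norm_num at h4 ⊢
        linarith
      nlinarith
  · have : ((|k| + 1 : ℤ) : ℝ) ≤ ((|m| : ℤ) : ℝ) := by exact_mod_cast h
    push_cast at this
    linarith

/-- One-sided version of the sliding step. -/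
lemma slide_one (p : ℝ) (hp : 1 < p) (u v : ℝ × ℝ) (hc : covol u v ≠ 0)
    (hu : pN p u = 1) (h1 : 1 ≤ pN p (v + (-1 : ℝ) • u))
    (hv : pN p v = 1)
    (hs : ∀ s : ℝ, 0 ≤ s → 1 ≤ pN p (v + s • u)) :
    ∃ a b : ℝ × ℝ, covol a b ≠ 0 ∧ pN p a = 1 ∧ pN p b = 1 ∧ pN p (a + b) = 1 ∧
      covol a b ≤ covol u v := by
  let g : ℝ → ℝ := fun s => pN p (v + s • u)
  have gc : Continuous g := (pN_cont p hp).comp (by fun_prop)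
  -- `F s = pN (v + (s - g s) u) - g s`
  let F : ℝ → ℝ := fun s => pN p (v + (s - g s) • u) - g s
  have Fc : Continuous F := ((pN_cont p hp).comp (by fun_prop)).sub gc
  have g0 : g 0 = 1 := by simp [g, hv]
  have F0 : 0 ≤ F 0 := by
    simp only [F, g0]
    have : (0 : ℝ) - 1 = -1 := by norm_num
    rw [this]; linarith
  have F3 : F 3 ≤ 0 := by
    have a1 : g 3 ≤ 4 := by
      have := pN_add p hp v ((3 : ℝ) • u)
      rw [pN_smul p hp, hu, hv] at this
      norm_num at this
      simp only [g]; linarith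
    have a2 : 2 ≤ g 3 := by
      have := pN_sub_le p hp ((3 : ℝ) • u) v
      rw [pN_smul p hp, hu, hv, add_comm] at this
      norm_num at this
      simp only [g]; linarith
    have a3 := pN_add p hp v ((3 - g 3) • u)
    rw [pN_smul p hp, hu, hv] at a3
    have a4 : |3 - g 3| ≤ 1 := by rw [abs_le]; constructor <;> linarith
    simp only [F]; linarith
  obtain ⟨s, hs03, hFs⟩ : ∃ s ∈ Set.Icc (0 : ℝ) 3, F s = 0 :=
    intermediate_value_Icc' (by norm_num : (0 : ℝ) ≤ 3) Fc.continuousOn ⟨F3, F0⟩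
  have gs : 1 ≤ g s := hs s hs03.1
  have gpos : 0 < g s := by linarith
  have hF : pN p (v + (s - g s) • u) = g s := by
    simp only [F] at hFs; linarith
  refine ⟨u, (g s)⁻¹ • (v + (s - g s) • u), ?_, hu, ?_, ?_, ?_⟩
  · have : covol u ((g s)⁻¹ • (v + (s - g s) • u)) = (g s)⁻¹ * covol u v := by
      unfold covol
      rw [← abs_of_pos (inv_pos.2 gpos), ← abs_mul, abs_of_pos (inv_pos.2 gpos)]
      congr 1
      simp
      ring
    rw [this]
    positivity
  · rw [pN_smul p hp, hF, abs_of_pos (inv_pos.2 gpos)]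
    field_simp
  · have e : u + (g s)⁻¹ • (v + (s - g s) • u) = (g s)⁻¹ • (v + s • u) := by
      ext <;> simp <;> field_simp <;> ring
    rw [e, pN_smul p hp, abs_of_pos (inv_pos.2 gpos)]
    exact inv_mul_cancel₀ gpos.ne'
  · have : covol u ((g s)⁻¹ • (v + (s - g s) • u)) = (g s)⁻¹ * covol u v := by
      unfold covol
      rw [← abs_of_pos (inv_pos.2 gpos), ← abs_mul, abs_of_pos (inv_pos.2 gpos)]
      congr 1
      simp
      ring
    rw [this]
    have h2 : 0 ≤ covol u v := abs_nonneg _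
    have h3 : (g s)⁻¹ ≤ 1 := inv_le_one_of_one_le₀ gs
    nlinarith

lemma slide (p : ℝ) (hp : 1 < p) (u v : ℝ × ℝ) (hc : covol u v ≠ 0)
    (hu : pN p u = 1) (h1 : 1 ≤ pN p (v + u)) (h2 : 1 ≤ pN p (v + (-1 : ℝ) • u))
    (hv : pN p v = 1) :
    ∃ a b : ℝ × ℝ, covol a b ≠ 0 ∧ pN p a = 1 ∧ pN p b = 1 ∧ pN p (a + b) = 1 ∧
      covol a b ≤ covol u v := by
  by_cases hs : ∀ s : ℝ, 0 ≤ s → 1 ≤ pN p (v + s • u)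
  · exact slide_one p hp u v hc hu h2 hv hs
  · push Not at hs
    obtain ⟨s, s0, hs⟩ := hs
    have e : covol (-u) v = covol u v := by
      unfold covol
      rw [← abs_neg]; congr 1; simp; ring
    rw [← e]
    refine slide_one p hp (-u) v (by rwa [e]) (by rwa [pN_neg]) (by simpa using h1) hv ?_
    intro t ht
    by_contra hlt
    push Not at hlt
    have hst : 0 < s + t := by
      rcases s0.eq_or_lt with h | h
      · rw [← h] at hs; simp [hv] at hs
      · linarith
    have key := pN_add p hp (t • (v + s • u)) (s • (v + t • (-u)))
    rw [pN_smul p hp, pN_smul p hp, abs_of_nonneg ht, abs_of_nonneg s0] at key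
    have e2 : t • (v + s • u) + s • (v + t • (-u)) = (s + t) • v := by module
    rw [e2, pN_smul p hp, hv, abs_of_pos hst] at key
    rcases s0.eq_or_lt with h | h
    · rw [← h] at hs; simp [hv] at hs
    · nlinarith [mul_nonneg ht (sub_nonneg.2 hs.le), mul_pos h (sub_pos.2 hlt)]

/-- Reduced pairs: normalise and slide. -/
lemma reduced_case (p : ℝ) (hp : 1 < p) (u v : ℝ × ℝ) (hc : covol u v ≠ 0)
    (hu : 1 ≤ pN p u) (huv : pN p u ≤ pN p v)
    (h1 : pN p v ≤ pN p (v + u)) (h2 : pN p v ≤ pN p (v + (-1 : ℝ) • u)) :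
    ∃ a b : ℝ × ℝ, covol a b ≠ 0 ∧ pN p a = 1 ∧ pN p b = 1 ∧ pN p (a + b) = 1 ∧
      covol a b ≤ covol u v := by
  set r := pN p u with hr
  set q := pN p v with hq
  have rpos : 0 < r := by linarith
  have qpos : 0 < q := by linarith
  have ec : covol (r⁻¹ • u) (q⁻¹ • v) = (r⁻¹ * q⁻¹) * covol u v := by
    have : |r⁻¹ * q⁻¹| = r⁻¹ * q⁻¹ := abs_of_pos (by positivity)
    unfold covol
    nth_rewrite 1 [← this]
    rw [← abs_mul]
    congr 1
    simp
    ring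
  have cpos : 0 < covol u v := lt_of_le_of_ne (abs_nonneg _) hc.symm
  -- for `|s| = t ≥ 1`
  have gen : ∀ w : ℝ × ℝ, q ≤ pN p (v + w) → ∀ t : ℝ, 1 ≤ t → q ≤ pN p (v + t • w) := by
    intro w hw t ht
    have key := pN_add p hp (v + t • w) ((t - 1) • v)
    have e : v + t • w + (t - 1) • v = t • (v + w) := by module
    rw [e, pN_smul p hp, pN_smul p hp, abs_of_pos (by linarith), abs_of_nonneg (by linarith),
      ← hq] at key
    nlinarith
  have ht : 1 ≤ q / r := by rw [le_div_iff₀ rpos]; linarith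
  have eabs : |q⁻¹| = q⁻¹ := abs_of_pos (inv_pos.2 qpos)
  obtain ⟨a, b, ha, hb, hab, hab2, hle⟩ := slide p hp (r⁻¹ • u) (q⁻¹ • v)
    (by rw [ec]; positivity)
    (by rw [pN_smul p hp, abs_of_pos (inv_pos.2 rpos), ← hr]; field_simp)
    (by
      have e : q⁻¹ • v + r⁻¹ • u = q⁻¹ • (v + (q / r) • u) := by
        ext <;> simp <;> field_simp
      rw [e, pN_smul p hp, eabs, ← div_eq_inv_mul, le_div_iff₀ qpos, one_mul]
      exact gen _ h1 _ ht)
    (by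
      have e : q⁻¹ • v + (-1 : ℝ) • r⁻¹ • u = q⁻¹ • (v + (q / r) • (-1 : ℝ) • u) := by
        ext <;> simp <;> field_simp
      rw [e, pN_smul p hp, eabs, ← div_eq_inv_mul, le_div_iff₀ qpos, one_mul]
      exact gen _ h2 _ ht)
    (by rw [pN_smul p hp, abs_of_pos (inv_pos.2 qpos), ← hq]; field_simp)
  refine ⟨a, b, ha, hb, hab, hab2, hle.trans ?_⟩
  rw [ec]
  have h3 : r⁻¹ ≤ 1 := inv_le_one_of_one_le₀ hu
  have h4 : q⁻¹ ≤ 1 := inv_le_one_of_one_le₀ (by linarith)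
  have h5 : r⁻¹ * q⁻¹ ≤ 1 := mul_le_one₀ h3 (by positivity) h4
  nlinarith

/-- The vector with coordinates `c` in the basis `u`, `v`. -/
def comb (u v : ℝ × ℝ) (c : ℤ × ℤ) : ℝ × ℝ := (c.1 : ℝ) • u + (c.2 : ℝ) • v

lemma comb_bound (p : ℝ) (hp : 1 < p) (u v : ℝ × ℝ) (hc : covol u v ≠ 0) (B : ℝ) :
    ∃ M : ℤ, ∀ c : ℤ × ℤ, pN p (comb u v c) ≤ B → |c.1| ≤ M ∧ |c.2| ≤ M := by
  have cpos : 0 < covol u v := lt_of_le_of_ne (abs_nonneg _) hc.symm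
  let K : ℝ := (B * (|u.1| + |u.2| + |v.1| + |v.2|)) / covol u v
  refine ⟨⌈K⌉, fun c hB => ?_⟩
  have b1 := (pN_fst p hp (comb u v c)).trans hB
  have b2 := (pN_snd p hp (comb u v c)).trans hB
  have B0 : 0 ≤ B := (abs_nonneg _).trans b1
  set z := comb u v c with hz
  have i1 : |(c.1 : ℝ)| * covol u v ≤ B * (|v.2| + |v.1|) := by
    have e : (c.1 : ℝ) * (u.1 * v.2 - u.2 * v.1) = z.1 * v.2 - z.2 * v.1 := by
      simp [hz, comb]; ring
    unfold covol
    rw [← abs_mul, e]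
    calc _ ≤ |z.1 * v.2| + |z.2 * v.1| := abs_sub _ _
      _ = |z.1| * |v.2| + |z.2| * |v.1| := by rw [abs_mul, abs_mul]
      _ ≤ B * |v.2| + B * |v.1| := by gcongr
      _ = _ := by ring
  have i2 : |(c.2 : ℝ)| * covol u v ≤ B * (|u.2| + |u.1|) := by
    have e : (c.2 : ℝ) * (u.1 * v.2 - u.2 * v.1) = u.1 * z.2 - u.2 * z.1 := by
      simp [hz, comb]; ring
    unfold covol
    rw [← abs_mul, e]
    calc _ ≤ |u.1 * z.2| + |u.2 * z.1| := abs_sub _ _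
      _ = |z.2| * |u.1| + |z.1| * |u.2| := by rw [abs_mul, abs_mul]; ring
      _ ≤ B * |u.1| + B * |u.2| := by gcongr
      _ = _ := by ring
  have n1 : 0 ≤ B * (|u.1| + |u.2|) := by positivity
  have n2 : 0 ≤ B * (|v.1| + |v.2|) := by positivity
  have j1 : |(c.1 : ℝ)| ≤ K := by
    simp only [K]; rw [le_div_iff₀ cpos]; linarith
  have j2 : |(c.2 : ℝ)| ≤ K := by
    simp only [K]; rw [le_div_iff₀ cpos]; linarith
  constructor
  · have := j1.trans (Int.le_ceil K)
    exact_mod_cast this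
  · have := j2.trans (Int.le_ceil K)
    exact_mod_cast this

lemma exists_min (p : ℝ) (hp : 1 < p) (u v : ℝ × ℝ) (hc : covol u v ≠ 0) :
    ∃ c d : ℤ × ℤ, |c.1 * d.2 - c.2 * d.1| = 1 ∧
      ∀ c' d' : ℤ × ℤ, |c'.1 * d'.2 - c'.2 * d'.1| = 1 →
        pN p (comb u v c) + pN p (comb u v d) ≤ pN p (comb u v c') + pN p (comb u v d') := by
  let f : (ℤ × ℤ) × (ℤ × ℤ) → ℝ := fun x => pN p (comb u v x.1) + pN p (comb u v x.2)
  let x0 : (ℤ × ℤ) × (ℤ × ℤ) := ((1, 0), (0, 1))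
  let S : Set ((ℤ × ℤ) × (ℤ × ℤ)) :=
    {x | |x.1.1 * x.2.2 - x.1.2 * x.2.1| = 1 ∧ f x ≤ f x0}
  have hx0 : x0 ∈ S := by simp [S, x0]
  have hfin : S.Finite := by
    obtain ⟨M, hM⟩ := comb_bound p hp u v hc (f x0)
    refine Set.Finite.subset (Set.finite_Icc ((-M, -M), (-M, -M)) ((M, M), (M, M))) ?_
    rintro ⟨c, d⟩ ⟨-, hx⟩
    simp only [f] at hx
    have a1 := hM c (by have := pN_nonneg p (comb u v d); simp only [f]; linarith)
    have a2 := hM d (by have := pN_nonneg p (comb u v c); simp only [f]; linarith)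
    simp only [abs_le] at a1 a2
    refine ⟨⟨⟨a1.1.1, a1.2.1⟩, ⟨a2.1.1, a2.2.1⟩⟩, ⟨⟨a1.1.2, a1.2.2⟩, ⟨a2.1.2, a2.2.2⟩⟩⟩
  obtain ⟨x, hxS, hx⟩ := Set.exists_min_image S f hfin ⟨x0, hx0⟩
  refine ⟨x.1, x.2, hxS.1, fun c' d' h => ?_⟩
  by_cases hle : f (c', d') ≤ f x0
  · exact hx (c', d') ⟨h, hle⟩
  · push Not at hle
    exact (hx x0 hx0).trans hle.le

lemma main_lemma (p : ℝ) (hp : 1 < p) (u v : ℝ × ℝ) (h : IsAdmissible p u v) :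
    ∃ a b : ℝ × ℝ, covol a b ≠ 0 ∧ pN p a = 1 ∧ pN p b = 1 ∧ pN p (a + b) = 1 ∧
      covol a b ≤ covol u v := by
  obtain ⟨hc, hadm⟩ := h
  obtain ⟨c, d, hdet, hmin⟩ := exists_min p hp u v hc
  -- symmetric: may assume `pN (comb c) ≤ pN (comb d)`
  have core : ∀ c d : ℤ × ℤ, |c.1 * d.2 - c.2 * d.1| = 1 →
      (∀ c' d' : ℤ × ℤ, |c'.1 * d'.2 - c'.2 * d'.1| = 1 →
        pN p (comb u v c) + pN p (comb u v d) ≤ pN p (comb u v c') + pN p (comb u v d')) →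
      pN p (comb u v c) ≤ pN p (comb u v d) →
      ∃ a b : ℝ × ℝ, covol a b ≠ 0 ∧ pN p a = 1 ∧ pN p b = 1 ∧ pN p (a + b) = 1 ∧
      covol a b ≤ covol u v := by
    intro c d hdet hmin hcd
    have ec : covol (comb u v c) (comb u v d) = covol u v := by
      have e : (comb u v c).1 * (comb u v d).2 - (comb u v c).2 * (comb u v d).1
          = ((c.1 * d.2 - c.2 * d.1 : ℤ) : ℝ) * (u.1 * v.2 - u.2 * v.1) := by
        simp [comb]; ring
      have e2 : |((c.1 * d.2 - c.2 * d.1 : ℤ) : ℝ)| = 1 := by exact_mod_cast hdet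
      unfold covol
      rw [e, abs_mul, e2, one_mul]
    rw [← ec]
    refine reduced_case p hp _ _ (by rwa [ec]) ?_ hcd ?_ ?_
    · rw [pN_ge_one p hp]
      refine hadm _ ⟨c.1, c.2, by
        rw [comb, Int.cast_smul_eq_zsmul, Int.cast_smul_eq_zsmul]⟩ ?_
      intro h0
      apply hc
      rw [← ec, h0]; simp [covol]
    · have := hmin c (d + c) (by rw [← hdet]; congr 1; simp; ring)
      have e : comb u v (d + c) = comb u v d + comb u v c := by
        simp only [comb, Prod.fst_add, Prod.snd_add]; push_cast; module
      rw [e] at this; linarith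
    · have := hmin c (d - c) (by rw [← hdet]; congr 1; simp; ring)
      have e : comb u v (d - c) = comb u v d + (-1 : ℝ) • comb u v c := by
        simp only [comb, Prod.fst_sub, Prod.snd_sub]; push_cast; module
      rw [e] at this; linarith
  rcases le_total (pN p (comb u v c)) (pN p (comb u v d)) with h | h
  · exact core c d hdet hmin h
  · refine core d c ?_ ?_ h
    · rw [← hdet, ← abs_neg]; congr 1; ring
    · intro c' d' h'
      have := hmin c' d' h'
      linarith

/-- The standard hexagon. -/
def stdHex : Set (ℝ × ℝ) := {z | |z.1| ≤ 1 ∧ |z.2| ≤ 1 ∧ |z.1 - z.2| ≤ 1}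

lemma hull_eq : convexHull ℝ ({(1, 0), (0, 1), (1, 1), (-1, 0), (0, -1), (-1, -1)} : Set (ℝ × ℝ))
    = stdHex := by
  apply Set.Subset.antisymm
  · refine convexHull_min ?_ ?_
    · intro z hz
      simp only [Set.mem_insert_iff, Set.mem_singleton_iff] at hz
      rcases hz with rfl | rfl | rfl | rfl | rfl | rfl <;> simp [stdHex]
    · intro z hz w hw a b ha hb hab
      simp only [stdHex, Set.mem_ofPred_eq, abs_le, Prod.fst_add, Prod.snd_add, Prod.smul_fst,
        Prod.smul_snd, smul_eq_mul] at hz hw ⊢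
      obtain ⟨⟨z1, z2⟩, ⟨z3, z4⟩, z5, z6⟩ := hz
      obtain ⟨⟨w1, w2⟩, ⟨w3, w4⟩, w5, w6⟩ := hw
      refine ⟨⟨?_, ?_⟩, ⟨?_, ?_⟩, ?_, ?_⟩ <;> nlinarith
  · rintro ⟨x, y⟩ ⟨h1, h2, h3⟩
    set T : Set (ℝ × ℝ) := {(1, 0), (0, 1), (1, 1), (-1, 0), (0, -1), (-1, -1)} with hT
    simp only [abs_le] at h1 h2 h3
    have hconv : Convex ℝ (convexHull ℝ T) := convex_convexHull ℝ T
    have sub : T ⊆ convexHull ℝ T := subset_convexHull ℝ T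
    have p1 : ((1, 0) : ℝ × ℝ) ∈ convexHull ℝ T := sub (by simp [hT])
    have p2 : ((0, 1) : ℝ × ℝ) ∈ convexHull ℝ T := sub (by simp [hT])
    have p3 : ((1, 1) : ℝ × ℝ) ∈ convexHull ℝ T := sub (by simp [hT])
    have p4 : ((-1, 0) : ℝ × ℝ) ∈ convexHull ℝ T := sub (by simp [hT])
    have p5 : ((0, -1) : ℝ × ℝ) ∈ convexHull ℝ T := sub (by simp [hT])
    have p6 : ((-1, -1) : ℝ × ℝ) ∈ convexHull ℝ T := sub (by simp [hT])
    have p0 : (0 : ℝ × ℝ) ∈ convexHull ℝ T := by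
      have := hconv p1 p4 (by norm_num : (0 : ℝ) ≤ 1 / 2) (by norm_num : (0 : ℝ) ≤ 1 / 2)
        (by norm_num)
      convert this using 1
      ext <;> simp
    have tri : ∀ P ∈ convexHull ℝ T, ∀ Q ∈ convexHull ℝ T, ∀ a b : ℝ, 0 ≤ a → 0 ≤ b → a + b ≤ 1 →
        a • P + b • Q ∈ convexHull ℝ T := by
      intro P hP Q hQ a b ha hb hab
      rcases (add_nonneg ha hb).eq_or_lt with h0 | h0
      · have a0 : a = 0 := by linarith
        have b0 : b = 0 := by linarith
        simpa [a0, b0] using p0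
      · have m := hconv hP hQ (a := a / (a + b)) (b := b / (a + b)) (by positivity)
          (by positivity) (by field_simp)
        have m2 := hconv m p0 (a := a + b) (b := 1 - (a + b)) h0.le (by linarith) (by ring)
        convert m2 using 1
        ext <;> simp <;> field_simp
    rcases le_total 0 x with hx | hx <;> rcases le_total 0 y with hy | hy
    · rcases le_total x y with hxy | hxy
      · convert tri _ p3 _ p2 x (y - x) hx (by linarith) (by linarith) using 1
        ext <;> simp
      · convert tri _ p3 _ p1 y (x - y) hy (by linarith) (by linarith) using 1
        ext <;> simp
    · convert tri _ p1 _ p5 x (-y) hx (by linarith) (by linarith) using 1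
      ext <;> simp
    · convert tri _ p4 _ p2 (-x) y (by linarith) hy (by linarith) using 1
      ext <;> simp
    · rcases le_total x y with hxy | hxy
      · convert tri _ p6 _ p4 (-y) (y - x) (by linarith) (by linarith) (by linarith) using 1
        ext <;> simp
      · convert tri _ p6 _ p5 (-x) (x - y) (by linarith) (by linarith) (by linarith) using 1
        ext <;> simp

lemma vol_stdHex : MeasureTheory.volume stdHex = 3 := by
  have hmeas : MeasurableSet stdHex := by
    have hcl : IsClosed stdHex := by
      have c1 : IsClosed {z : ℝ × ℝ | |z.1| ≤ 1} := isClosed_le (by fun_prop) (by fun_prop)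
      have c2 : IsClosed {z : ℝ × ℝ | |z.2| ≤ 1} := isClosed_le (by fun_prop) (by fun_prop)
      have c3 : IsClosed {z : ℝ × ℝ | |z.1 - z.2| ≤ 1} := isClosed_le (by fun_prop) (by fun_prop)
      exact c1.inter (c2.inter c3)
    exact hcl.measurableSet
  rw [MeasureTheory.Measure.volume_eq_prod, MeasureTheory.Measure.prod_apply hmeas]
  have hsec : ∀ x : ℝ, MeasureTheory.volume (Prod.mk x ⁻¹' stdHex)
      = (Set.Icc (-1 : ℝ) 1).indicator (fun x => ENNReal.ofReal (2 - |x|)) x := by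
    intro x
    by_cases hx : x ∈ Set.Icc (-1 : ℝ) 1
    · rw [Set.indicator_of_mem hx]
      have e : Prod.mk x ⁻¹' stdHex = Set.Icc (max (-1) (x - 1)) (min 1 (x + 1)) := by
        ext y
        simp only [stdHex, Set.mem_preimage, Set.mem_ofPred_eq, abs_le, Set.mem_Icc, max_le_iff,
          le_min_iff]
        constructor
        · rintro ⟨h1, h2, h3⟩
          refine ⟨⟨?_, ?_⟩, ?_, ?_⟩ <;> linarith
        · rintro ⟨⟨h1, h2⟩, h3, h4⟩
          refine ⟨⟨hx.1, hx.2⟩, ⟨?_, ?_⟩, ?_, ?_⟩ <;> linarith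
      rw [e, Real.volume_Icc]
      congr 1
      rcases le_total 0 x with h | h
      · rw [min_eq_left (by linarith), max_eq_right (by linarith), abs_of_nonneg h]; ring
      · rw [min_eq_right (by linarith), max_eq_left (by linarith), abs_of_nonpos h]; ring
    · rw [Set.indicator_of_notMem hx]
      have e : Prod.mk x ⁻¹' stdHex = ∅ := by
        ext y
        simp only [stdHex, Set.mem_preimage, Set.mem_ofPred_eq, Set.mem_empty_iff_false, iff_false]
        rintro ⟨h1, -⟩
        exact hx (abs_le.1 h1)
      rw [e]; simp
  simp_rw [hsec]
  rw [MeasureTheory.lintegral_indicator measurableSet_Icc,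
    ← MeasureTheory.ofReal_integral_eq_lintegral_ofReal]
  · rw [MeasureTheory.integral_Icc_eq_integral_Ioc,
      ← intervalIntegral.integral_of_le (by norm_num)]
    have c : Continuous (fun x : ℝ => 2 - |x|) := by fun_prop
    rw [← intervalIntegral.integral_add_adjacent_intervals (b := 0)
      (c.intervalIntegrable _ _) (c.intervalIntegrable _ _)]
    have e1 : ∫ x in (-1 : ℝ)..0, (2 - |x|) = ∫ x in (-1 : ℝ)..0, (2 + x) := by
      apply intervalIntegral.integral_congr
      intro x hx
      rw [Set.uIcc_of_le (by norm_num)] at hx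
      simp only [abs_of_nonpos hx.2]; ring
    have e2 : ∫ x in (0 : ℝ)..1, (2 - |x|) = ∫ x in (0 : ℝ)..1, (2 - x) := by
      apply intervalIntegral.integral_congr
      intro x hx
      rw [Set.uIcc_of_le (by norm_num)] at hx
      simp only [abs_of_nonneg hx.1]
    rw [e1, e2, intervalIntegral.integral_add (by simp) (by simp),
      intervalIntegral.integral_sub (by simp) (by simp)]
    simp
    norm_num
  · have c : Continuous (fun x : ℝ => 2 - |x|) := by fun_prop
    exact c.continuousOn.integrableOn_compact isCompact_Icc
  · refine (MeasureTheory.ae_restrict_iff' measurableSet_Icc).2 (Filter.Eventually.of_forall ?_)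
    intro x hx
    have := abs_le.2 hx
    simp only [Pi.zero_apply]
    linarith

lemma hex_area (u v : ℝ × ℝ) :
    (MeasureTheory.volume
      (convexHull ℝ ({u, v, u + v, -u, -v, -(u + v)} : Set (ℝ × ℝ)))).toReal = 3 * covol u v := by
  let L : (ℝ × ℝ) →ₗ[ℝ] (ℝ × ℝ) :=
    Matrix.toLin (Module.Basis.finTwoProd ℝ) (Module.Basis.finTwoProd ℝ) !![u.1, v.1; u.2, v.2]
  have hL : ∀ z, L z = (u.1 * z.1 + v.1 * z.2, u.2 * z.1 + v.2 * z.2) := by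
    intro z; simp only [L]; rw [Matrix.toLin_finTwoProd_apply]
  have hdet : LinearMap.det L = u.1 * v.2 - v.1 * u.2 := by
    simp only [L]
    rw [LinearMap.det_toLin, Matrix.det_fin_two_of]
  have himg : ({u, v, u + v, -u, -v, -(u + v)} : Set (ℝ × ℝ))
      = L '' ({(1, 0), (0, 1), (1, 1), (-1, 0), (0, -1), (-1, -1)} : Set (ℝ × ℝ)) := by
    simp only [Set.image_insert_eq, Set.image_singleton, hL]
    congr 1
    · ext <;> simp
    congr 1
    · ext <;> simp
    congr 1
    · ext <;> simp
    congr 1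
    · ext <;> simp
    congr 1
    · ext <;> simp
    congr 1
    ext <;> simp <;> ring
  rw [himg, ← LinearMap.image_convexHull, hull_eq,
    MeasureTheory.Measure.addHaar_image_linearMap, vol_stdHex, hdet]
  rw [ENNReal.toReal_mul, ENNReal.toReal_ofReal (abs_nonneg _)]
  unfold covol
  rw [mul_comm v.1 u.2, mul_comm]
  simp

lemma adm_std (p : ℝ) (hp : 1 < p) : IsAdmissible p (1, 0) (0, 1) := by
  refine ⟨by simp [covol], ?_⟩
  rintro z ⟨m, k, rfl⟩ hz
  rw [← pN_ge_one p hp]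
  by_cases hm : m = 0
  · have hk : k ≠ 0 := by
      rintro rfl
      simp [hm] at hz
    refine le_trans ?_ (pN_snd p hp _)
    have := Int.one_le_abs hk
    simp
    exact_mod_cast this
  · refine le_trans ?_ (pN_fst p hp _)
    have := Int.one_le_abs hm
    simp
    exact_mod_cast this

/-- For real `p > 1`, the infimum, over admissible lattices of `D_p`
with a `ℤ`-basis `u`, `v` such that `u`, `v`, `u+v` all lie on the boundary curve
`|x|ᵖ + |y|ᵖ = 1`, of the area of the inscribed hexagon `conv{±u, ±v, ±(u+v)}`,
equals `3·Δ(D_p)`. -/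
theorem statement_8 (p : ℝ) (hp : 1 < p) :
    sInf {A : ℝ | ∃ u v : ℝ × ℝ, IsAdmissible p u v ∧
          |u.1| ^ p + |u.2| ^ p = 1 ∧ |v.1| ^ p + |v.2| ^ p = 1 ∧
          |(u + v).1| ^ p + |(u + v).2| ^ p = 1 ∧
          A = (MeasureTheory.volume
              (convexHull ℝ ({u, v, u + v, -u, -v, -(u + v)} : Set (ℝ × ℝ)))).toReal}
      = 3 * criticalDet p := by
  have key : ∀ u v : ℝ × ℝ, IsAdmissible p u v → ∃ a b : ℝ × ℝ, IsAdmissible p a b ∧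
      |a.1| ^ p + |a.2| ^ p = 1 ∧ |b.1| ^ p + |b.2| ^ p = 1 ∧
      |(a + b).1| ^ p + |(a + b).2| ^ p = 1 ∧ covol a b ≤ covol u v := by
    intro u v h
    obtain ⟨a, b, hc, ha, hb, hab, hle⟩ := main_lemma p hp u v h
    exact ⟨a, b, adm_of_three p hp a b hc ha hb hab, (pN_eq_one p hp a).1 ha,
      (pN_eq_one p hp b).1 hb, (pN_eq_one p hp (a + b)).1 hab, hle⟩
  simp only [hex_area]
  have bdd1 : BddBelow {d : ℝ | ∃ u v : ℝ × ℝ, IsAdmissible p u v ∧ d = covol u v} := by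
    refine ⟨0, ?_⟩
    rintro d ⟨u, v, -, rfl⟩
    exact abs_nonneg _
  apply le_antisymm
  · have h : ∀ S : ℝ, (∀ d ∈ {d : ℝ | ∃ u v : ℝ × ℝ, IsAdmissible p u v ∧ d = covol u v},
        S / 3 ≤ d) → S ≤ 3 * criticalDet p := by
      intro S hS
      have ne : {d : ℝ | ∃ u v : ℝ × ℝ, IsAdmissible p u v ∧ d = covol u v}.Nonempty :=
        ⟨_, (1, 0), (0, 1), adm_std p hp, rfl⟩
      have := le_csInf ne hS
      unfold criticalDet
      linarith
    apply h
    rintro d ⟨u, v, hadm, rfl⟩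
    obtain ⟨a, b, hab, h1, h2, h3, hle⟩ := key u v hadm
    rw [div_le_iff₀ (by norm_num)]
    refine le_trans (b := 3 * covol a b) ?_ (by linarith)
    refine csInf_le ?_ ?_
    swap
    · exact ⟨a, b, hab, h1, h2, h3, rfl⟩
    refine ⟨0, ?_⟩
    rintro A ⟨u, v, -, -, -, -, rfl⟩
    have : 0 ≤ covol u v := abs_nonneg _
    positivity
  · apply le_csInf
    · obtain ⟨a, b, hab, h1, h2, h3, hle⟩ := key _ _ (adm_std p hp)
      exact ⟨_, a, b, hab, h1, h2, h3, rfl⟩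
    · rintro A ⟨u, v, hadm, -, -, -, rfl⟩
      have := csInf_le bdd1 ⟨u, v, hadm, rfl⟩
      unfold criticalDet
      linarith

end
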